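/- There exist universal constants μ > 0, c > 0 and C > 0 such that for every integer m ≥ 1 there exists a finite connected simple graph H with maximal degree at most 6 and c·2^{10m} ≤ |V(H)| ≤ C·2^{10m}, containing two disjoint vertex sets B and W with |B| = 2^m and |W| = 2^{10m}, such that for the discrete-time simple random walk on H the following hold: (i) for every b ∈ B, Pr_b[T_{B∖{b}} < T_W] ≤ C·2^{−4m}; (ii) for every h ∈ V(H), c·|V(H)|/2^m ≤ E_h[T_{B∖{h}}] ≤ C·|V(H)|/2^m; (iii) for every h ∈ V(H), Pr_h[T_{B∖{h}} > |V(H)|/2^m] ≥ c; (iv) for every b ∈ B, Pr_b[T_W < T_b⁺ | T_W < T_{B∖{b}}] ≥ μ, and moreover this conditional probability is the same for all b ∈ B; (v) for every v ∈ W and every b ∈ B, the probability that the walk started at v first visits B at the vertex b equals 2^{−m} (i.e. Pr_v[X_{T_B} = b] = 2^{−m}). -/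

import Mathlib

open Finset
open scoped Classical

variable {V : Type*} [Fintype V] [DecidableEq V]

/-- Degree of a vertex in a simple graph. -/
noncomputable def graphDeg (H : SimpleGraph V) (x : V) : ℕ :=
  (Finset.univ.filter (fun y => H.Adj x y)).card

/-- Transition matrix of the discrete-time simple random walk on `H`. -/
noncomputable def srwP (H : SimpleGraph V) : Matrix V V ℝ :=
  fun x y => if H.Adj x y then 1 / (graphDeg H x : ℝ) else 0

/-- `hitBeforeSeq P A C t x` is `Pr_x[T_A ≤ t and T_A < T_C]`; its supremum over `t`
is `Pr_x[T_A < T_C]`. -/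
noncomputable def hitBeforeSeq (P : Matrix V V ℝ) (A C : Finset V) : ℕ → V → ℝ
  | 0, x => if x ∈ A then 1 else 0
  | t + 1, x => if x ∈ A then 1 else if x ∈ C then 0
      else ∑ y, P x y * hitBeforeSeq P A C t y

/-- `Pr_x[T_A < T_C]` for the chain with transition matrix `P`. -/
noncomputable def prHitBefore (P : Matrix V V ℝ) (A C : Finset V) (x : V) : ℝ :=
  ⨆ t : ℕ, hitBeforeSeq P A C t x

/-- `survSeq P A t x = Pr_x[T_A > t]`. -/
noncomputable def survSeq (P : Matrix V V ℝ) (A : Finset V) : ℕ → V → ℝ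
  | 0, x => if x ∈ A then 0 else 1
  | t + 1, x => if x ∈ A then 0 else ∑ y, P x y * survSeq P A t y

/-- `E_x[T_A] = ∑_{t≥0} Pr_x[T_A > t]`. -/
noncomputable def expHit (P : Matrix V V ℝ) (A : Finset V) (x : V) : ℝ :=
  ∑' t : ℕ, survSeq P A t x

/-- `hitAtSeq P B b t x` increases to `Pr_x[X_{T_B} = b]`, the probability that the walk
first visits `B` at the vertex `b`. -/
noncomputable def hitAtSeq (P : Matrix V V ℝ) (B : Finset V) (b : V) : ℕ → V → ℝ
  | 0, x => if x = b then 1 else 0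
  | t + 1, x => if x = b then 1 else if x ∈ B then 0
      else ∑ y, P x y * hitAtSeq P B b t y

/-- `Pr_x[X_{T_B} = b]`. -/
noncomputable def prHitAt (P : Matrix V V ℝ) (B : Finset V) (b : V) (x : V) : ℝ :=
  ⨆ t : ℕ, hitAtSeq P B b t x

/-- `Pr_b[T_W < T_b⁺ | T_W < T_{B∖{b}}]`, written as a ratio: the numerator
`Pr_b[T_W < T_B⁺] = ∑_y P(b,y)·Pr_y[T_W < T_B]` (for `b ∈ B`, reaching `W` before returning
to `B` at all is the event `{T_W < T_b⁺} ∩ {T_W < T_{B∖{b}}}`). -/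
noncomputable def condEscapeProb (P : Matrix V V ℝ) (B W : Finset V) (b : V) : ℝ :=
  (∑ y, P b y * prHitBefore P W B y) / prHitBefore P W (B.erase b) b

section general

lemma ax_hb_nonneg {P : Matrix V V ℝ} (hP : ∀ x y, 0 ≤ P x y) (A C : Finset V) (t : ℕ) (x : V) :
    0 ≤ hitBeforeSeq P A C t x := by
  induction t generalizing x with
  | zero => simp only [hitBeforeSeq]; split_ifs <;> norm_num
  | succ t ih =>
    simp only [hitBeforeSeq]
    split_ifs
    · norm_num
    · exact le_rfl
    · exact Finset.sum_nonneg fun y _ => mul_nonneg (hP x y) (ih y)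

lemma ax_hb_le {P : Matrix V V ℝ} (hP : ∀ x y, 0 ≤ P x y) {A C : Finset V} (g : V → ℝ)
    (g0 : ∀ x, 0 ≤ g x) (gA : ∀ x ∈ A, 1 ≤ g x)
    (gs : ∀ x, x ∉ A → x ∉ C → ∑ y, P x y * g y ≤ g x) (t : ℕ) (x : V) :
    hitBeforeSeq P A C t x ≤ g x := by
  induction t generalizing x with
  | zero => simp only [hitBeforeSeq]; split_ifs with h
            · exact gA x h
            · exact g0 x
  | succ t ih =>
    simp only [hitBeforeSeq]
    split_ifs with h h2
    · exact gA x h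
    · exact g0 x
    · exact (Finset.sum_le_sum fun y _ => mul_le_mul_of_nonneg_left (ih y) (hP x y)).trans
        (gs x h h2)

lemma ax_hb_mono_succ {P : Matrix V V ℝ} (hP : ∀ x y, 0 ≤ P x y) (A C : Finset V) (t : ℕ) (x : V) :
    hitBeforeSeq P A C t x ≤ hitBeforeSeq P A C (t+1) x := by
  induction t generalizing x with
  | zero =>
    rw [hitBeforeSeq]
    split_ifs with h
    · simp [hitBeforeSeq, h]
    · exact ax_hb_nonneg hP A C _ x
  | succ t ih =>
    rw [hitBeforeSeq, hitBeforeSeq]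
    split_ifs
    · exact le_rfl
    · exact le_rfl
    · exact Finset.sum_le_sum fun y _ => mul_le_mul_of_nonneg_left (ih y) (hP x y)

lemma ax_hb_le_one {P : Matrix V V ℝ} (hP : ∀ x y, 0 ≤ P x y) (h1 : ∀ x, ∑ y, P x y = 1)
    (A C : Finset V) (t : ℕ) (x : V) : hitBeforeSeq P A C t x ≤ 1 :=
  ax_hb_le hP (fun _ => 1) (fun _ => by norm_num) (fun _ _ => le_rfl)
    (fun x _ _ => by simp [h1 x]) t x

lemma ax_hb_bdd {P : Matrix V V ℝ} (hP : ∀ x y, 0 ≤ P x y) (h1 : ∀ x, ∑ y, P x y = 1)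
    (A C : Finset V) (x : V) : BddAbove (Set.range fun t => hitBeforeSeq P A C t x) := by
  refine ⟨1, ?_⟩
  rintro _ ⟨t, rfl⟩
  exact ax_hb_le_one hP h1 A C t x

lemma ax_hb_tendsto {P : Matrix V V ℝ} (hP : ∀ x y, 0 ≤ P x y) (h1 : ∀ x, ∑ y, P x y = 1)
    (A C : Finset V) (x : V) :
    Filter.Tendsto (fun t => hitBeforeSeq P A C t x) Filter.atTop (nhds (prHitBefore P A C x)) :=
  tendsto_atTop_ciSup (monotone_nat_of_le_succ fun t => ax_hb_mono_succ hP A C t x)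
    (ax_hb_bdd hP h1 A C x)

lemma ax_pr_le {P : Matrix V V ℝ} (hP : ∀ x y, 0 ≤ P x y) {A C : Finset V} (g : V → ℝ)
    (g0 : ∀ x, 0 ≤ g x) (gA : ∀ x ∈ A, 1 ≤ g x)
    (gs : ∀ x, x ∉ A → x ∉ C → ∑ y, P x y * g y ≤ g x) (x : V) :
    prHitBefore P A C x ≤ g x :=
  ciSup_le fun t => ax_hb_le hP g g0 gA gs t x

lemma ax_pr_harm {P : Matrix V V ℝ} (hP : ∀ x y, 0 ≤ P x y) (h1 : ∀ x, ∑ y, P x y = 1)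
    (A C : Finset V) (x : V) (hA : x ∉ A) (hC : x ∉ C) :
    ∑ y, P x y * prHitBefore P A C y = prHitBefore P A C x := by
  have l1 := (ax_hb_tendsto hP h1 A C x).comp (Filter.tendsto_add_atTop_nat 1)
  have l2 : Filter.Tendsto (fun t => ∑ y, P x y * hitBeforeSeq P A C t y) Filter.atTop
      (nhds (∑ y, P x y * prHitBefore P A C y)) :=
    tendsto_finsetSum _ fun y _ => (ax_hb_tendsto hP h1 A C y).const_mul _
  refine tendsto_nhds_unique (l2.congr fun t => ?_) l1
  simp [hitBeforeSeq, hA, hC]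

lemma ax_hitAt_eq (P : Matrix V V ℝ) (B : Finset V) (b : V) (t : ℕ) (x : V) :
    hitAtSeq P B b t x = hitBeforeSeq P {b} B t x := by
  induction t generalizing x with
  | zero => simp [hitAtSeq, hitBeforeSeq]
  | succ t ih => simp [hitAtSeq, hitBeforeSeq, ih]

lemma ax_prHitAt_eq (P : Matrix V V ℝ) (B : Finset V) (b : V) (x : V) :
    prHitAt P B b x = prHitBefore P {b} B x := by
  simp only [prHitAt, prHitBefore, ax_hitAt_eq]

lemma ax_surv_nonneg {P : Matrix V V ℝ} (hP : ∀ x y, 0 ≤ P x y) (A : Finset V) (t : ℕ) (x : V) :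
    0 ≤ survSeq P A t x := by
  induction t generalizing x with
  | zero => simp only [survSeq]; split_ifs <;> norm_num
  | succ t ih =>
    simp only [survSeq]
    split_ifs
    · exact le_rfl
    · exact Finset.sum_nonneg fun y _ => mul_nonneg (hP x y) (ih y)

lemma ax_surv_anti {P : Matrix V V ℝ} (hP : ∀ x y, 0 ≤ P x y) {A A' : Finset V} (h : A ⊆ A')
    (t : ℕ) (x : V) : survSeq P A' t x ≤ survSeq P A t x := by
  induction t generalizing x with
  | zero =>
    simp only [survSeq]; split_ifs with h1 h2 h2 <;> first | exact absurd (h h2) h1 | norm_num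
  | succ t ih =>
    by_cases h1 : x ∈ A'
    · have := ax_surv_nonneg hP A (t+1) x
      simpa [survSeq, h1] using this
    · have h2 : x ∉ A := fun h2 => h1 (h h2)
      simp only [survSeq, h1, h2, if_false]
      exact Finset.sum_le_sum fun y _ => mul_le_mul_of_nonneg_left (ih y) (hP x y)

lemma ax_surv_ge {P : Matrix V V ℝ} (hP : ∀ x y, 0 ≤ P x y) {A : Finset V} (w : V → ℝ) (lam : ℝ)
    (hl : 0 ≤ lam) (w1 : ∀ x, w x ≤ 1) (wA : ∀ x ∈ A, w x ≤ 0)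
    (ws : ∀ x, x ∉ A → lam * w x ≤ ∑ y, P x y * w y) (t : ℕ) (x : V) :
    lam ^ t * w x ≤ survSeq P A t x := by
  induction t generalizing x with
  | zero =>
    simp only [survSeq]; split_ifs with h
    · simpa using wA x h
    · simpa using w1 x
  | succ t ih =>
    simp only [survSeq]; split_ifs with h
    · exact mul_nonpos_of_nonneg_of_nonpos (by positivity) (wA x h)
    · calc lam ^ (t+1) * w x = lam ^ t * (lam * w x) := by ring
        _ ≤ lam ^ t * ∑ y, P x y * w y := mul_le_mul_of_nonneg_left (ws x h) (by positivity)
        _ = ∑ y, P x y * (lam ^ t * w y) := by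
            rw [Finset.mul_sum]; exact Finset.sum_congr rfl fun y _ => by ring
        _ ≤ _ := Finset.sum_le_sum fun y _ => mul_le_mul_of_nonneg_left (ih y) (hP x y)

lemma ax_surv_sum_le {P : Matrix V V ℝ} (hP : ∀ x y, 0 ≤ P x y) {A : Finset V} (g : V → ℝ)
    (g0 : ∀ x, 0 ≤ g x) (gs : ∀ x, x ∉ A → 1 + ∑ y, P x y * g y ≤ g x) (n : ℕ) (x : V) :
    ∑ t ∈ Finset.range n, survSeq P A t x ≤ g x := by
  induction n generalizing x with
  | zero => simpa using g0 x
  | succ n ih =>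
    by_cases h : x ∈ A
    · have : ∀ t, survSeq P A t x = 0 := by intro t; cases t <;> simp [survSeq, h]
      simpa [this] using g0 x
    · rw [Finset.sum_range_succ']
      simp only [survSeq, h, if_false]
      rw [Finset.sum_comm]
      refine le_trans ?_ (gs x h)
      rw [add_comm]
      gcongr with y
      rw [← Finset.mul_sum]
      exact mul_le_mul_of_nonneg_left (ih y) (hP x y)

lemma ax_surv_summable {P : Matrix V V ℝ} (hP : ∀ x y, 0 ≤ P x y) {A : Finset V} (g : V → ℝ)
    (g0 : ∀ x, 0 ≤ g x) (gs : ∀ x, x ∉ A → 1 + ∑ y, P x y * g y ≤ g x) (x : V) :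
    Summable (fun t => survSeq P A t x) ∧ expHit P A x ≤ g x :=
  ⟨summable_of_sum_range_le (fun t => ax_surv_nonneg hP A t x) (ax_surv_sum_le hP g g0 gs · x),
   Real.tsum_le_of_sum_range_le (fun t => ax_surv_nonneg hP A t x) (ax_surv_sum_le hP g g0 gs · x)⟩

lemma ax_compl_seq {P : Matrix V V ℝ} (h1 : ∀ x, ∑ y, P x y = 1)
    {A C : Finset V} (h : Disjoint A C) (t : ℕ) (x : V) :
    hitBeforeSeq P A C t x + hitBeforeSeq P C A t x + survSeq P (A ∪ C) t x = 1 := by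
  induction t generalizing x with
  | zero =>
    by_cases hA : x ∈ A
    · have hC : x ∉ C := Finset.disjoint_left.1 h hA
      simp [hitBeforeSeq, survSeq, hA, hC]
    · by_cases hC : x ∈ C <;> simp [hitBeforeSeq, survSeq, hA, hC]
  | succ t ih =>
    by_cases hA : x ∈ A
    · have hC : x ∉ C := Finset.disjoint_left.1 h hA
      simp [hitBeforeSeq, survSeq, hA, hC]
    · by_cases hC : x ∈ C
      · simp [hitBeforeSeq, survSeq, hA, hC]
      · simp only [hitBeforeSeq, survSeq, hA, hC, if_false, Finset.mem_union, or_self]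
        rw [← Finset.sum_add_distrib, ← Finset.sum_add_distrib, ← h1 x]
        refine Finset.sum_congr rfl fun y _ => ?_
        rw [← mul_add, ← mul_add, ih y, mul_one]

lemma ax_compl {P : Matrix V V ℝ} (hP : ∀ x y, 0 ≤ P x y) (h1 : ∀ x, ∑ y, P x y = 1)
    {A C : Finset V} (h : Disjoint A C) (x : V)
    (hs : Summable (fun t => survSeq P A t x)) :
    prHitBefore P A C x + prHitBefore P C A x = 1 := by
  have hz : Filter.Tendsto (fun t => survSeq P (A ∪ C) t x) Filter.atTop (nhds 0) :=
    squeeze_zero (fun t => ax_surv_nonneg hP _ t x)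
      (fun t => ax_surv_anti hP Finset.subset_union_left t x) hs.tendsto_atTop_zero
  have l := ((ax_hb_tendsto hP h1 A C x).add (ax_hb_tendsto hP h1 C A x)).add hz
  rw [add_zero] at l
  refine tendsto_nhds_unique l (tendsto_const_nhds.congr fun t => ?_)
  exact (ax_compl_seq h1 h t x).symm

lemma ax_sum_seq {P : Matrix V V ℝ} (h1 : ∀ x, ∑ y, P x y = 1)
    (B : Finset V) (t : ℕ) (x : V) :
    ∑ b ∈ B, hitBeforeSeq P {b} B t x + survSeq P B t x = 1 := by
  induction t generalizing x with
  | zero =>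
    by_cases hB : x ∈ B <;> simp [hitBeforeSeq, survSeq, hB]
  | succ t ih =>
    by_cases hB : x ∈ B
    · simp [hitBeforeSeq, survSeq, hB]
    · simp only [survSeq, hB, if_false]
      have : ∀ b ∈ B, hitBeforeSeq P {b} B (t+1) x = ∑ y, P x y * hitBeforeSeq P {b} B t y := by
        intro b hb
        have : x ≠ b := fun h => hB (h ▸ hb)
        simp [hitBeforeSeq, hB, this]
      rw [Finset.sum_congr rfl this, Finset.sum_comm, ← Finset.sum_add_distrib, ← h1 x]
      refine Finset.sum_congr rfl fun y _ => ?_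
      rw [← Finset.mul_sum, ← mul_add, ih y, mul_one]

lemma ax_sum {P : Matrix V V ℝ} (hP : ∀ x y, 0 ≤ P x y) (h1 : ∀ x, ∑ y, P x y = 1)
    (B : Finset V) (x : V) (hs : Summable (fun t => survSeq P B t x)) :
    ∑ b ∈ B, prHitBefore P {b} B x = 1 := by
  have l := (tendsto_finsetSum B fun b _ => ax_hb_tendsto hP h1 {b} B x).add hs.tendsto_atTop_zero
  rw [add_zero] at l
  refine tendsto_nhds_unique l (tendsto_const_nhds.congr fun t => ?_)
  exact (ax_sum_seq h1 B t x).symm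

lemma ax_hb_aut {P : Matrix V V ℝ} (σ : V ≃ V) (hσ : ∀ x y, P (σ x) (σ y) = P x y)
    {A C A' C' : Finset V} (hA : ∀ x, σ x ∈ A' ↔ x ∈ A) (hC : ∀ x, σ x ∈ C' ↔ x ∈ C)
    (t : ℕ) (x : V) : hitBeforeSeq P A' C' t (σ x) = hitBeforeSeq P A C t x := by
  induction t generalizing x with
  | zero => simp [hitBeforeSeq, hA]
  | succ t ih =>
    simp only [hitBeforeSeq, hA, hC]
    congr 2
    rw [← Equiv.sum_comp σ]
    exact Finset.sum_congr rfl fun y _ => by rw [hσ, ih]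

lemma ax_pr_aut {P : Matrix V V ℝ} (σ : V ≃ V) (hσ : ∀ x y, P (σ x) (σ y) = P x y)
    {A C A' C' : Finset V} (hA : ∀ x, σ x ∈ A' ↔ x ∈ A) (hC : ∀ x, σ x ∈ C' ↔ x ∈ C)
    (x : V) : prHitBefore P A' C' (σ x) = prHitBefore P A C x := by
  simp only [prHitBefore, ax_hb_aut σ hσ hA hC]

lemma ax_reach {H : SimpleGraph V} (b : V) (C : Finset V) (t : ℕ) (x : V)
    (h : hitBeforeSeq (srwP H) {b} C t x ≠ 0) : H.Reachable x b := by
  induction t generalizing x with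
  | zero =>
    simp [hitBeforeSeq] at h
    subst h; exact SimpleGraph.Reachable.refl _
  | succ t ih =>
    simp only [hitBeforeSeq] at h
    split_ifs at h with h1 h2
    · rw [Finset.mem_singleton] at h1; subst h1; exact SimpleGraph.Reachable.refl _
    · exact absurd rfl h
    · obtain ⟨y, -, hy⟩ := Finset.exists_ne_zero_of_sum_ne_zero h
      have hy1 := left_ne_zero_of_mul hy
      have hadj : H.Adj x y := by
        by_contra hn
        exact hy1 (by simp [srwP, hn])
      exact hadj.reachable.trans (ih y (right_ne_zero_of_mul hy))

end general

set_option linter.unusedSectionVars false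
set_option linter.unusedVariables false

section good

/-- The combinatorial data of the layered graph. -/
structure AxGood (m : ℕ) (H : SimpleGraph V) (lv : V → ℕ) (root : V → (Fin m → Bool)) : Prop where
  le : ∀ v, lv v ≤ 9 * m + 1
  adj : ∀ v w, H.Adj v w → lv w = lv v + 1 ∨ lv v = lv w + 1
  down_pos : ∀ v, 0 < lv v → 0 < #{w | H.Adj v w ∧ lv v = lv w + 1}
  up : ∀ v, 0 < lv v → lv v < 9 * m + 1 →
    #{w | H.Adj v w ∧ lv w = lv v + 1} = 2 * #{w | H.Adj v w ∧ lv v = lv w + 1}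
  up0 : ∀ v, lv v = 0 → 0 < #{w | H.Adj v w ∧ lv w = lv v + 1}
  deg : ∀ v, graphDeg H v ≤ 6
  cardB : #{v | lv v = 0} = 2 ^ m
  cardW : #{v | lv v = 9 * m + 1} = 2 ^ (10 * m)
  card : Fintype.card V ≤ 4 * 2 ^ (10 * m)
  root_adj : ∀ v w, H.Adj v w → lv v ≤ 4 * m → lv w ≤ 4 * m → root v = root w
  root_inj : ∀ v w, lv v = 0 → lv w = 0 → root v = root w → v = w
  aut : ∀ b b', lv b = 0 → lv b' = 0 → ∃ σ : V ≃ V, (∀ v w, H.Adj (σ v) (σ w) ↔ H.Adj v w) ∧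
    (∀ v, lv (σ v) = lv v) ∧ (∀ v, lv v = 9 * m + 1 → σ v = v) ∧ σ b = b'

variable {m : ℕ} {H : SimpleGraph V} {lv : V → ℕ} {root : V → (Fin m → Bool)}

lemma ax_P_nonneg (H : SimpleGraph V) (x y : V) : 0 ≤ srwP H x y := by
  unfold srwP; split_ifs <;> positivity

lemma ax_P_sum (x : V) (g : V → ℝ) :
    ∑ y, srwP H x y * g y = (∑ y with H.Adj x y, g y) / graphDeg H x := by
  rw [Finset.sum_filter, Finset.sum_div]
  refine Finset.sum_congr rfl fun y _ => ?_
  unfold srwP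
  split_ifs <;> ring

lemma AxGood.nbr (G : AxGood m H lv root) (v : V) (f : V → ℝ) :
    ∑ y with H.Adj v y, f y = ∑ y with H.Adj v y ∧ lv y = lv v + 1, f y
      + ∑ y with H.Adj v y ∧ lv v = lv y + 1, f y := by
  rw [← Finset.sum_union]
  · refine Finset.sum_congr ?_ fun _ _ => rfl
    ext y
    simp only [Finset.mem_filter, Finset.mem_univ, true_and, Finset.mem_union]
    constructor
    · intro h; rcases G.adj v y h with h' | h' <;> tauto
    · tauto
  · rw [Finset.disjoint_left]
    simp only [Finset.mem_filter, Finset.mem_univ, true_and]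
    rintro y ⟨_, h1⟩ ⟨_, h2⟩
    omega

lemma AxGood.deg_eq (G : AxGood m H lv root) (v : V) :
    (graphDeg H v : ℝ) = (#{w | H.Adj v w ∧ lv w = lv v + 1} : ℝ)
      + #{w | H.Adj v w ∧ lv v = lv w + 1} := by
  have := G.nbr v (fun _ => 1)
  simpa [graphDeg] using this

lemma AxGood.down0 (G : AxGood m H lv root) (v : V) (hv : lv v = 0) :
    #{w | H.Adj v w ∧ lv v = lv w + 1} = 0 := by
  rw [Finset.card_eq_zero, Finset.filter_eq_empty_iff]
  rintro y _ ⟨_, h⟩; omega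

lemma AxGood.upL (G : AxGood m H lv root) (v : V) (hv : lv v = 9 * m + 1) :
    #{w | H.Adj v w ∧ lv w = lv v + 1} = 0 := by
  rw [Finset.card_eq_zero, Finset.filter_eq_empty_iff]
  rintro y _ ⟨_, h⟩; have := G.le y; omega

/-- Averages, with pointwise upper bounds on the neighbours. -/
lemma AxGood.avg_lv (G : AxGood m H lv root) (F : ℕ → ℝ) (v : V) :
    ∑ y, srwP H v y * F (lv y) =
      (#{w | H.Adj v w ∧ lv w = lv v + 1} * F (lv v + 1)
        + #{w | H.Adj v w ∧ lv v = lv w + 1} * F (lv v - 1)) / graphDeg H v := by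
  rw [ax_P_sum, G.nbr]
  congr 2
  · rw [Finset.sum_congr rfl (g := fun _ => F (lv v + 1)), Finset.sum_const, nsmul_eq_mul]
    intro y hy
    rw [(Finset.mem_filter.1 hy).2.2]
  · rw [Finset.sum_congr rfl (g := fun _ => F (lv v - 1)), Finset.sum_const, nsmul_eq_mul]
    intro y hy
    rw [(Finset.mem_filter.1 hy).2.2, Nat.add_sub_cancel]

lemma AxGood.avg0 (G : AxGood m H lv root) (F : ℕ → ℝ) (v : V) (hv : lv v = 0) :
    ∑ y, srwP H v y * F (lv y) = F 1 := by
  have h := G.up0 v hv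
  rw [G.avg_lv, G.deg_eq, G.down0 v hv, hv]
  rw [hv] at h
  have : (0:ℝ) < #{w | H.Adj v w ∧ lv w = 0 + 1} := by exact_mod_cast h
  field_simp
  simp [mul_comm]

lemma AxGood.avgL (G : AxGood m H lv root) (F : ℕ → ℝ) (v : V) (hv : lv v = 9 * m + 1) :
    ∑ y, srwP H v y * F (lv y) = F (9 * m) := by
  have h := G.down_pos v (by omega)
  rw [G.avg_lv, G.deg_eq, G.upL v hv, hv]
  rw [hv] at h
  have : (0:ℝ) < #{w | H.Adj v w ∧ 9 * m + 1 = lv w + 1} := by exact_mod_cast h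
  field_simp
  simp

lemma AxGood.avgM (G : AxGood m H lv root) (F : ℕ → ℝ) (v : V) (j : ℕ) (hv : lv v = j + 1)
    (hj : j < 9 * m) :
    ∑ y, srwP H v y * F (lv y) = 2 / 3 * F (j + 2) + 1 / 3 * F j := by
  have h := G.down_pos v (by omega)
  rw [G.avg_lv, G.deg_eq, G.up v (by omega) (by omega)]
  have : (0:ℝ) < #{w | H.Adj v w ∧ lv v = lv w + 1} := by exact_mod_cast h
  push_cast
  rw [hv] at this ⊢
  rw [Nat.add_sub_cancel, show j + 1 + 1 = j + 2 from rfl]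
  field_simp
  ring

lemma AxGood.row (G : AxGood m H lv root) (v : V) : ∑ y, srwP H v y = 1 := by
  have key : ∑ y, srwP H v y * (fun _ : ℕ => (1:ℝ)) (lv y) = 1 := by
    rcases Nat.eq_zero_or_pos (lv v) with h | h
    · rw [G.avg0 (fun _ : ℕ => (1:ℝ)) v h]
    · rcases (G.le v).lt_or_eq with h2 | h2
      · rw [G.avgM (fun _ : ℕ => (1:ℝ)) v (lv v - 1) (by omega) (by omega)]; norm_num
      · rw [G.avgL (fun _ : ℕ => (1:ℝ)) v h2]
  simpa using key

/-- monotonicity of averages over neighbours -/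
lemma ax_P_mono (x : V) (f g : V → ℝ) (h : ∀ y, H.Adj x y → f y ≤ g y) :
    ∑ y, srwP H x y * f y ≤ ∑ y, srwP H x y * g y := by
  rw [ax_P_sum, ax_P_sum]
  gcongr with y hy
  exact h y (Finset.mem_filter.1 hy).2

/-- generic superharmonicity of level functions -/
lemma AxGood.cases (G : AxGood m H lv root) (v : V) :
    lv v = 0 ∨ (∃ j < 9 * m, lv v = j + 1) ∨ lv v = 9 * m + 1 := by
  have := G.le v
  rcases Nat.eq_zero_or_pos (lv v) with h | h
  · exact Or.inl h
  · rcases this.lt_or_eq with h2 | h2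
    · exact Or.inr (Or.inl ⟨lv v - 1, by omega, by omega⟩)
    · exact Or.inr (Or.inr h2)

/-- `2 ^ (-level)` is harmonic strictly between the bottom and the top. -/
lemma AxGood.harm (G : AxGood m H lv root) (v : V) (j : ℕ) (hv : lv v = j + 1) (hj : j < 9 * m) :
    ∑ y, srwP H v y * (1/2 : ℝ) ^ (lv y) = (1/2 : ℝ) ^ (lv v) := by
  rw [G.avgM (fun i => (1/2:ℝ)^i) v j hv hj, hv]
  ring

/-- (i) -/
lemma AxGood.part1 (G : AxGood m H lv root) (b : V) (hb : lv b = 0) :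
    prHitBefore (srwP H) ((Finset.univ.filter fun v => lv v = 0).erase b)
      (Finset.univ.filter fun v => lv v = 9 * m + 1) b ≤ 1 / 2 ^ (4 * m) := by
  set g : V → ℝ := fun v => if root v = root b ∧ lv v ≤ 4 * m then (1/2) ^ (4*m)
    else (1/2) ^ (lv v) with hg
  have hgle : ∀ v, g v ≤ (1/2) ^ (lv v) := by
    intro v
    simp only [hg]
    split_ifs with h
    · exact pow_le_pow_of_le_one (by norm_num) (by norm_num) h.2
    · exact le_rfl
  have := ax_pr_le (ax_P_nonneg H) (A := (Finset.univ.filter fun v => lv v = 0).erase b)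
    (C := Finset.univ.filter fun v => lv v = 9 * m + 1) g ?_ ?_ ?_ b
  · refine this.trans ?_
    simp [hg, hb]
  · intro v; simp only [hg]; split_ifs <;> positivity
  · intro v hv
    simp only [Finset.mem_erase, Finset.mem_filter, Finset.mem_univ, true_and] at hv
    have : root v ≠ root b := fun h => hv.1 (G.root_inj v b hv.2 hb h)
    simp [hg, this, hv.2]
  · intro v hv hv2
    simp only [Finset.mem_erase, Finset.mem_filter, Finset.mem_univ, true_and, not_and] at hv hv2
    by_cases hr : root v = root b ∧ lv v ≤ 4 * m
    · have e : g v = (1/2)^(4*m) := by simp [hg, hr]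
      rw [e]
      calc ∑ y, srwP H v y * g y ≤ ∑ y, srwP H v y * (1/2:ℝ)^(4*m) := by
            apply ax_P_mono
            intro y hy
            by_cases hy2 : lv y ≤ 4 * m
            · have := G.root_adj v y hy hr.2 hy2
              simp [hg, ← this, hr.1, hy2]
            · refine (hgle y).trans ?_
              exact pow_le_pow_of_le_one (by norm_num) (by norm_num) (by omega)
        _ = _ := by rw [← Finset.sum_mul, G.row, one_mul]
    · have hv0 : lv v ≠ 0 := by
        intro h0
        have : v ≠ b := by rintro rfl; exact hr ⟨rfl, by omega⟩
        exact hv this h0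
      have e : g v = (1/2)^(lv v) := by simp [hg, hr]
      rw [e]
      rcases G.cases v with h | ⟨j, hj, h⟩ | h
      · exact absurd h hv0
      · rw [← G.harm v j h hj]
        exact ax_P_mono _ _ _ fun y _ => hgle y
      · exact absurd h hv2

/-- The level function bounding the expected hitting time of the bottom level. -/
noncomputable def axF (m : ℕ) (j : ℕ) : ℝ := 4 * 2 ^ (9 * m + 1) * (1 - (1/2)^j) - 3 * j

lemma axF_le (m j : ℕ) : axF m j ≤ 4 * 2 ^ (9 * m + 1) := by
  unfold axF
  have : (0:ℝ) ≤ 4 * 2 ^ (9 * m + 1) * (1/2)^j := by positivity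
  have : (0:ℝ) ≤ j := by positivity
  linarith

lemma axF_nonneg (hm : 1 ≤ m) (j : ℕ) (hj : j ≤ 9 * m + 1) : 0 ≤ axF m j := by
  rcases j with _ | j
  · simp [axF]
  · unfold axF
    have h1 : ((1:ℝ)/2)^(j+1) ≤ 1/2 := by
      calc ((1:ℝ)/2)^(j+1) ≤ (1/2)^1 := pow_le_pow_of_le_one (by norm_num) (by norm_num) (by omega)
        _ = 1/2 := by norm_num
    have h2 : ((9 * m + 1 : ℕ) : ℝ) + 1 ≤ 2 ^ (9 * m + 1) := by
      exact_mod_cast (Nat.lt_two_pow_self (n := 9 * m + 1))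
    have h3 : ((j + 1 : ℕ) : ℝ) ≤ ((9 * m + 1 : ℕ) : ℝ) := by exact_mod_cast hj
    have h5 : (8:ℝ) ≤ 2 ^ (9 * m) := by
      calc (8:ℝ) = 2 ^ 3 := by norm_num
        _ ≤ _ := pow_le_pow_right₀ (by norm_num) (by omega)
    have h6 : ((9 * m : ℕ) : ℝ) + 1 ≤ 2 ^ (9 * m) := by
      exact_mod_cast (Nat.lt_two_pow_self (n := 9 * m))
    have h7 : (4:ℝ) * 2 ^ (9 * m + 1) * (1/2) ≤ 4 * 2 ^ (9 * m + 1) * (1 - (1/2)^(j+1)) := by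
      gcongr; linarith
    have h8 : (2:ℝ) ^ (9 * m + 1) = 2 * 2 ^ (9 * m) := by ring
    push_cast at *
    rw [h8] at h7 ⊢
    linarith

lemma AxGood.F_super (G : AxGood m H lv root) (v : V) (hv : lv v ≠ 0) :
    1 + ∑ y, srwP H v y * axF m (lv y) ≤ axF m (lv v) := by
  rcases G.cases v with h | ⟨j, hj, h⟩ | h
  · exact absurd h hv
  · rw [G.avgM _ v j h hj, h]
    unfold axF
    push_cast
    ring_nf
    exact le_rfl
  · rw [G.avgL _ v h, h]
    unfold axF
    have : (2:ℝ) ^ (9 * m + 1) * (1/2)^(9*m+1) = 1 := by rw [← mul_pow]; norm_num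
    have h2 : (2:ℝ) ^ (9 * m + 1) * (1/2)^(9*m) = 2 := by
      rw [pow_succ]
      have : (2:ℝ) ^ (9 * m) * (1/2)^(9*m) = 1 := by rw [← mul_pow]; norm_num
      linarith
    push_cast
    linarith

lemma AxGood.summB (G : AxGood m H lv root) (hm : 1 ≤ m) (x : V) :
    Summable (fun t => survSeq (srwP H) (Finset.univ.filter fun v => lv v = 0) t x) ∧
    expHit (srwP H) (Finset.univ.filter fun v => lv v = 0) x ≤ 4 * 2 ^ (9 * m + 1) := by
  have := ax_surv_summable (ax_P_nonneg H) (A := Finset.univ.filter fun v => lv v = 0)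
    (fun v => axF m (lv v)) (fun v => axF_nonneg hm _ (G.le v))
    (fun v hv => G.F_super v (by simpa using hv)) x
  exact ⟨this.1, this.2.trans (axF_le _ _)⟩

lemma AxGood.P_aut (σ : V ≃ V) (h : ∀ v w, H.Adj (σ v) (σ w) ↔ H.Adj v w) (x y : V) :
    srwP H (σ x) (σ y) = srwP H x y := by
  have : graphDeg H (σ x) = graphDeg H x := by
    unfold graphDeg
    symm
    refine Finset.card_equiv σ ?_
    intro i; simp [h]
  unfold srwP
  simp only [this, h]

/-- (v) -/
lemma AxGood.part5 (G : AxGood m H lv root) (hm : 1 ≤ m) (v b : V) (hv : lv v = 9 * m + 1)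
    (hb : lv b = 0) :
    prHitBefore (srwP H) {b} (Finset.univ.filter fun v => lv v = 0) v = 1 / 2 ^ m := by
  have hsum := ax_sum (ax_P_nonneg H) G.row (Finset.univ.filter fun v => lv v = 0) v
    (G.summB hm v).1
  have : ∀ b' ∈ Finset.univ.filter (fun v => lv v = 0),
      prHitBefore (srwP H) {b'} (Finset.univ.filter fun v => lv v = 0) v
      = prHitBefore (srwP H) {b} (Finset.univ.filter fun v => lv v = 0) v := by
    intro b' hb'
    simp only [Finset.mem_filter, Finset.mem_univ, true_and] at hb'
    obtain ⟨σ, h1, h2, h3, h4⟩ := G.aut b b' hb hb'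
    have := ax_pr_aut (P := srwP H) σ (AxGood.P_aut σ h1) (A := {b}) (A' := {b'})
      (C := Finset.univ.filter fun v => lv v = 0) (C' := Finset.univ.filter fun v => lv v = 0)
      (by intro x; rw [← h4]; simp) (by intro x; simp [h2]) v
    rw [h3 v hv] at this
    exact this
  rw [Finset.sum_congr rfl this, Finset.sum_const, G.cardB, nsmul_eq_mul] at hsum
  push_cast at hsum
  rw [eq_div_iff (by positivity)]
  linarith

lemma ax_half (hm : 1 ≤ m) : (1:ℝ) / 2 ^ m ≤ 1 / 2 := by
  have : (2:ℝ)^1 ≤ 2 ^ m := pow_le_pow_right₀ (by norm_num) hm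
  exact one_div_le_one_div_of_le (by norm_num) (by linarith)

lemma AxGood.q_le (G : AxGood m H lv root) (hm : 1 ≤ m) (b : V) (hb : lv b = 0) (v : V) :
    prHitBefore (srwP H) {b} (Finset.univ.filter fun v => lv v = 0) v
      ≤ 1 / 2 + 1 / 2 * (1 / 2) ^ (lv v) := by
  refine ciSup_le fun t => ?_
  have hL : ∀ t v, lv v = 9 * m + 1 →
      hitBeforeSeq (srwP H) {b} (Finset.univ.filter fun v => lv v = 0) t v ≤ 1 / 2 := by
    intro t v hv
    refine le_trans ?_ (ax_half hm)
    rw [← G.part5 hm v b hv hb]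
    exact le_ciSup (ax_hb_bdd (ax_P_nonneg H) G.row _ _ v) t
  induction t generalizing v with
  | zero =>
    simp only [hitBeforeSeq]
    split_ifs with h
    · rw [Finset.mem_singleton] at h; subst h; simp [hb]; norm_num
    · positivity
  | succ t ih =>
    rcases G.cases v with h | ⟨j, hj, h⟩ | h
    · simp only [hitBeforeSeq]
      split_ifs with h1 h2
      · simp [h]; norm_num
      · positivity
      · exact absurd (by simpa using h) h2
    · have h1 : v ∉ ({b} : Finset V) := by
        rw [Finset.mem_singleton]; rintro rfl; omega
      have h2 : v ∉ Finset.univ.filter fun v => lv v = 0 := by simp [h]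
      rw [hitBeforeSeq, if_neg h1, if_neg h2]
      refine (ax_P_mono v _ _ fun y _ => ih y).trans ?_
      rw [G.avgM (fun i => 1/2 + 1/2 * (1/2:ℝ)^i) v j h hj, h]
      ring_nf
      exact le_rfl
    · refine (hL _ _ h).trans ?_
      have : (0:ℝ) ≤ 1 / 2 * (1/2)^(lv v) := by positivity
      linarith

/-- upper half of (ii) together with summability -/
lemma AxGood.part2u (G : AxGood m H lv root) (hm : 1 ≤ m) (h : V) :
    Summable (fun t => survSeq (srwP H) ((Finset.univ.filter fun v => lv v = 0).erase h) t h) ∧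
    expHit (srwP H) ((Finset.univ.filter fun v => lv v = 0).erase h) h ≤ 16 * 2 ^ (9 * m + 1) := by
  by_cases hB : lv h = 0
  swap
  · rw [Finset.erase_eq_of_notMem (by simpa using hB)]
    refine ⟨(G.summB hm h).1, (G.summB hm h).2.trans ?_⟩
    gcongr; norm_num
  set B := Finset.univ.filter fun v => lv v = 0 with hBdef
  set q := prHitBefore (srwP H) {h} B with hq
  set X : ℝ := 12 * 2 ^ (9 * m + 1) with hX
  have hX0 : 0 ≤ X := by positivity
  have hq0 : ∀ v, 0 ≤ q v := fun v =>
    (ax_hb_nonneg (ax_P_nonneg H) {h} B 0 v).trans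
      (le_ciSup (ax_hb_bdd (ax_P_nonneg H) G.row {h} B v) 0)
  have hq1 : q h = 1 := by
    have : ∀ t, hitBeforeSeq (srwP H) {h} B t h = 1 := by
      intro t; cases t <;> simp [hitBeforeSeq]
    simp [hq, prHitBefore, this]
  have hsplit : ∀ v, ∑ y, srwP H v y * (axF m (lv y) + X * q y)
      = ∑ y, srwP H v y * axF m (lv y) + X * ∑ y, srwP H v y * q y := by
    intro v
    rw [Finset.mul_sum, ← Finset.sum_add_distrib]
    exact Finset.sum_congr rfl fun y _ => by ring
  have := ax_surv_summable (ax_P_nonneg H) (A := B.erase h)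
    (fun v => axF m (lv v) + X * q v)
    (fun v => add_nonneg (axF_nonneg hm _ (G.le v)) (mul_nonneg hX0 (hq0 v))) ?_ h
  · refine ⟨this.1, this.2.trans ?_⟩
    simp only [hq1]
    have := axF_le m (lv h)
    linarith
  · intro v hv
    rw [hsplit]
    by_cases hvh : v = h
    · subst hvh
      have e1 := G.avg0 (axF m) v hB
      have e2 : ∑ y, srwP H v y * q y ≤ 3 / 4 := by
        refine (ax_P_mono v _ _ fun y _ => G.q_le hm v hB y).trans ?_
        rw [G.avg0 (fun i => 1/2 + 1/2 * (1/2:ℝ)^i) v hB]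
        norm_num
      rw [e1, hq1, hB]
      have e3 : X * ∑ y, srwP H v y * q y ≤ X * (3/4) := mul_le_mul_of_nonneg_left e2 hX0
      have e4 : axF m 1 = 2 * 2 ^ (9 * m + 1) - 3 := by unfold axF; push_cast; ring
      have e5 : axF m 0 = 0 := by simp [axF]
      rw [e4, e5]
      have : (1:ℝ) ≤ 2 ^ (9 * m + 1) := one_le_pow₀ (by norm_num)
      linarith
    · have hvB : v ∉ B := fun h' => hv (Finset.mem_erase.2 ⟨hvh, h'⟩)
      have e1 := ax_pr_harm (ax_P_nonneg H) G.row {h} B v (by simpa using hvh) hvB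
      have e2 := G.F_super v (by simpa [hBdef] using hvB)
      rw [← hq] at e1
      rw [e1]
      linarith

lemma ax_pow_lb (n t : ℕ) (hn : 2 ≤ n) (ht : t ≤ 2 * 2 ^ n) :
    (1/256 : ℝ) ≤ (1 - 2 * (1/2)^n) ^ t := by
  obtain ⟨k, rfl⟩ : ∃ k, n = k + 2 := ⟨n - 2, by omega⟩
  have h0 : ((1:ℝ)/2)^k ≤ 1 := pow_le_one₀ (by norm_num) (by norm_num)
  have h00 : (0:ℝ) ≤ (1/2)^k := by positivity
  have e : (1 - 2 * (1/2:ℝ)^(k+2)) = 1 - (1/2)^k / 2 := by ring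
  rw [e]
  have h1 : (1/2 : ℝ) ≤ (1 - (1/2)^k/2) ^ (2^k) := by
    have := one_add_mul_le_pow (a := -((1/2:ℝ)^k/2)) (by linarith) (2^k)
    have e2 : (2:ℝ)^k * (1/2)^k = 1 := by rw [← mul_pow]; norm_num
    calc (1/2:ℝ) = 1 + ((2^k : ℕ) : ℝ) * (-((1/2:ℝ)^k/2)) := by
          push_cast; linarith
      _ ≤ _ := this
      _ = _ := by ring
  calc (1/256:ℝ) = (1/2)^8 := by norm_num
    _ ≤ ((1 - (1/2)^k/2) ^ (2^k))^8 := by gcongr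
    _ = (1 - (1/2)^k/2) ^ (2^k * 8) := by rw [pow_mul]
    _ ≤ _ := pow_le_pow_of_le_one (by linarith) (by linarith) (by rw [pow_add] at ht; omega)

/-- (iii) in slightly more general form -/
lemma AxGood.part3 (G : AxGood m H lv root) (hm : 1 ≤ m) (h : V) (t : ℕ)
    (ht : t ≤ 2 * 2 ^ (9 * m + 1)) :
    1 / 512 ≤ survSeq (srwP H) ((Finset.univ.filter fun v => lv v = 0).erase h) t h := by
  set lam : ℝ := 1 - 2 * (1/2)^(9*m+1) with hlam
  set w : V → ℝ := fun v => max (1 - (1/2)^(lv v)) (if v = h then 1/2 else 0) with hw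
  have hs : ∀ v, (1:ℝ) - (1/2)^(lv v) ≤ w v := fun v => le_max_left _ _
  have hp : ∀ n : ℕ, (0:ℝ) ≤ (1/2)^n := fun n => by positivity
  have hp1 : ∀ n : ℕ, ((1:ℝ)/2)^(n+1) ≤ 1/2 := fun n => by
    calc ((1:ℝ)/2)^(n+1) ≤ (1/2)^1 := pow_le_pow_of_le_one (by norm_num) (by norm_num) (by omega)
        _ = 1/2 := by norm_num
  have hl0 : 0 ≤ lam := by have := hp1 (9*m); linarith
  have hl1 : lam ≤ 1 := by have := hp (9*m+1); linarith
  have := ax_surv_ge (ax_P_nonneg H) (A := (Finset.univ.filter fun v => lv v = 0).erase h)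
    w lam hl0 ?_ ?_ ?_ t h
  · have hwh : 1/2 ≤ w h := by simp [hw]
    have hpow := ax_pow_lb (9*m+1) t (by omega) ht
    refine le_trans ?_ this
    calc (1/512:ℝ) = 1/256 * (1/2) := by norm_num
      _ ≤ _ := mul_le_mul hpow hwh (by norm_num) (by positivity)
  · intro x
    refine max_le (by linarith [hp (lv x)]) ?_
    split_ifs <;> norm_num
  · intro x hx
    simp only [Finset.mem_erase, Finset.mem_filter, Finset.mem_univ, true_and] at hx
    simp [hw, hx.1, hx.2]
  · intro v hv
    refine le_trans ?_ (ax_P_mono v _ _ fun y _ => hs y)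
    by_cases h0 : lv v = 0
    · have hvh : v = h := by
        by_contra hne
        exact hv (by simp [hne, h0])
      rw [G.avg0 (fun i => 1 - (1/2:ℝ)^i) v h0]
      have : w v = 1/2 := by simp [hw, hvh]; rw [← hvh, h0]; norm_num
      rw [this]; linarith
    · have hw' : w v = 1 - (1/2)^(lv v) := by
        apply max_eq_left
        obtain ⟨n, hn⟩ := Nat.exists_eq_succ_of_ne_zero h0
        have := hp1 n
        rw [hn, Nat.succ_eq_add_one]
        split_ifs <;> linarith
      rw [hw']
      rcases G.cases v with h' | ⟨j, hj, h'⟩ | h'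
      · exact absurd h' h0
      · rw [G.avgM (fun i => 1 - (1/2:ℝ)^i) v j h' hj, h']
        have := hp1 j
        calc lam * (1 - (1/2)^(j+1)) ≤ 1 * (1 - (1/2)^(j+1)) := by gcongr; linarith
          _ = _ := by ring
      · rw [G.avgL (fun i => 1 - (1/2:ℝ)^i) v h', h']
        have e : ((1:ℝ)/2)^(9*m) = 2 * (1/2)^(9*m+1) := by ring
        rw [e, hlam]
        have := hp1 (9*m)
        have := hp (9*m+1)
        nlinarith

/-- lower half of (ii) -/
lemma AxGood.part2l (G : AxGood m H lv root) (hm : 1 ≤ m) (h : V) (N : ℕ)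
    (hN : N ≤ 2 * 2 ^ (9 * m + 1)) :
    ((N:ℝ) + 1) / 512 ≤ expHit (srwP H) ((Finset.univ.filter fun v => lv v = 0).erase h) h := by
  have hsum := (G.part2u hm h).1
  have := hsum.sum_le_tsum (Finset.range (N+1)) (fun t _ => ax_surv_nonneg (ax_P_nonneg H) _ t h)
  refine le_trans ?_ this
  calc ((N:ℝ) + 1) / 512 = ∑ t ∈ Finset.range (N+1), (1/512:ℝ) := by
        rw [Finset.sum_const, Finset.card_range, nsmul_eq_mul]; push_cast; ring
    _ ≤ _ := Finset.sum_le_sum fun t ht => G.part3 hm h t (by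
        have := Finset.mem_range.1 ht; omega)

lemma AxGood.disj (lv : V → ℕ) : Disjoint (Finset.univ.filter fun v => lv v = 0)
    (Finset.univ.filter fun v => lv v = 9 * m + 1) := by
  rw [Finset.disjoint_left]; intro x; simp; omega

/-- (iv), the bound -/
lemma AxGood.part4 (G : AxGood m H lv root) (hm : 1 ≤ m) (b : V) (hb : lv b = 0) :
    1 / 2 ≤ condEscapeProb (srwP H) (Finset.univ.filter fun v => lv v = 0)
      (Finset.univ.filter fun v => lv v = 9 * m + 1) b := by
  unfold condEscapeProb
  set B := Finset.univ.filter fun v => lv v = 0 with hB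
  set W := Finset.univ.filter fun v => lv v = 9 * m + 1 with hW
  have hd : Disjoint B W := AxGood.disj lv
  have num : 1/2 ≤ ∑ y, srwP H b y * prHitBefore (srwP H) W B y := by
    have h1 : ∀ y, 1 - (1/2:ℝ)^(lv y) ≤ prHitBefore (srwP H) W B y := by
      intro y
      have e := ax_compl (ax_P_nonneg H) G.row hd y (G.summB hm y).1
      have e2 := ax_pr_le (ax_P_nonneg H) (A := B) (C := W) (fun v => (1/2:ℝ)^(lv v))
        (fun v => by positivity) (fun v hv => by
          have : lv v = 0 := by simpa [hB] using hv
          simp [this]) (fun v hv hv2 => by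
          rcases G.cases v with h | ⟨j, hj, h⟩ | h
          · exact absurd (by simpa [hB] using h) hv
          · exact (G.harm v j h hj).le
          · exact absurd (by simpa [hW] using h) hv2) y
      linarith
    refine le_trans ?_ (ax_P_mono b _ _ fun y _ => h1 y)
    rw [G.avg0 (fun i => 1 - (1/2:ℝ)^i) b hb]
    norm_num
  have hd' : Disjoint (B.erase b) W := Finset.disjoint_of_subset_left (Finset.erase_subset _ _) hd
  have e := ax_compl (ax_P_nonneg H) G.row hd' b (G.part2u hm b).1
  have e2 := G.part1 b hb
  have e3 : (1:ℝ) / 2 ^ (4 * m) ≤ 1 / 2 := ax_half (by omega)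
  have den0 : 0 < prHitBefore (srwP H) W (B.erase b) b := by
    linarith
  have den1 : prHitBefore (srwP H) W (B.erase b) b ≤ 1 :=
    ciSup_le fun t => ax_hb_le_one (ax_P_nonneg H) G.row _ _ t b
  rw [le_div_iff₀ den0]
  linarith

/-- (iv), equality -/
lemma AxGood.part4' (G : AxGood m H lv root) (b b' : V) (hb : lv b = 0) (hb' : lv b' = 0) :
    condEscapeProb (srwP H) (Finset.univ.filter fun v => lv v = 0)
      (Finset.univ.filter fun v => lv v = 9 * m + 1) b =
    condEscapeProb (srwP H) (Finset.univ.filter fun v => lv v = 0)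
      (Finset.univ.filter fun v => lv v = 9 * m + 1) b' := by
  obtain ⟨σ, h1, h2, h3, h4⟩ := G.aut b b' hb hb'
  have hσ := AxGood.P_aut σ h1
  unfold condEscapeProb
  subst h4
  congr 1
  · rw [← Equiv.sum_comp σ (fun y => srwP H (σ b) y * _)]
    refine Finset.sum_congr rfl fun y _ => ?_
    rw [hσ, ax_pr_aut σ hσ]
    · intro x; simp [h2]
    · intro x; simp [h2]
  · rw [ax_pr_aut σ hσ]
    · intro x; simp [h2]
    · intro x; simp [h2]

lemma AxGood.to_bottom (G : AxGood m H lv root) (n : ℕ) (v : V) (hv : lv v = n) :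
    ∃ b, lv b = 0 ∧ H.Reachable v b := by
  induction n generalizing v with
  | zero => exact ⟨v, hv, SimpleGraph.Reachable.refl _⟩
  | succ n ih =>
    obtain ⟨w, hw⟩ := Finset.card_pos.1 (G.down_pos v (by omega))
    simp only [Finset.mem_filter, Finset.mem_univ, true_and] at hw
    obtain ⟨b, hb, hr⟩ := ih w (by omega)
    exact ⟨b, hb, hw.1.reachable.trans hr⟩

lemma AxGood.conn (G : AxGood m H lv root) (hm : 1 ≤ m) : H.Connected := by
  obtain ⟨w, hw⟩ : ∃ w, lv w = 9 * m + 1 := by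
    have : 0 < #{v | lv v = 9 * m + 1} := by rw [G.cardW]; positivity
    obtain ⟨w, hw⟩ := Finset.card_pos.1 this
    exact ⟨w, by simpa using hw⟩
  have hr : ∀ b, lv b = 0 → H.Reachable w b := by
    intro b hb
    have h5 := G.part5 hm w b hw hb
    by_contra hn
    have : ∀ t, hitBeforeSeq (srwP H) {b} (Finset.univ.filter fun v => lv v = 0) t w = 0 := by
      intro t
      by_contra h
      exact hn (ax_reach b _ t w h)
    rw [prHitBefore] at h5
    simp only [this, ciSup_const] at h5
    have : (0:ℝ) < 1 / 2 ^ m := by positivity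
    linarith
  have hr2 : ∀ v, H.Reachable w v := by
    intro v
    obtain ⟨b, hb, h⟩ := G.to_bottom _ v rfl
    exact (hr b hb).trans h.symm
  have : Nonempty V := ⟨w⟩
  exact SimpleGraph.Connected.mk fun u v => (hr2 u).symm.trans (hr2 v)

end good

section concrete

/-- branching number between levels `j` and `j+1` -/
def axQ (m j : ℕ) : ℕ := if j = 4 * m then 1 else 2

/-- number of words at level `j` -/
def axN (m j : ℕ) : ℕ := if j ≤ 4 * m then 2 ^ j else 2 ^ (j - 1)

/-- which root coordinates are allowed to change between levels `j` and `j+1` -/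
def axR (m j : ℕ) (x x' : Fin m → Bool) : Prop :=
  ∀ i : Fin m, (4 * m ≤ j ∧ (i : ℕ) = (j - 4 * m) % m) ∨ x i = x' i

abbrev AxV (m : ℕ) : Type :=
  {a : ℕ × (Fin m → Bool) × ℕ // a.1 ≤ 9 * m + 1 ∧ a.2.2 < axN m a.1}

def axUp {m : ℕ} (a b : ℕ × (Fin m → Bool) × ℕ) : Prop :=
  b.1 = a.1 + 1 ∧ axR m a.1 a.2.1 b.2.1 ∧ a.2.2 = b.2.2 / axQ m a.1

lemma axN_succ (m j : ℕ) : axN m (j+1) = axN m j * axQ m j := by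
  unfold axN axQ
  rcases lt_trichotomy j (4 * m) with h | h | h
  · rw [if_pos (by omega), if_pos (by omega), if_neg (by omega), pow_succ]
  · rw [if_neg (by omega), if_pos (by omega), if_pos h, mul_one, Nat.add_sub_cancel]
  · rw [if_neg (by omega), if_neg (by omega), if_neg (by omega), Nat.add_sub_cancel, ← pow_succ]
    congr 1; omega

lemma axN_le (m j : ℕ) : axN m j ≤ 2 ^ j := by
  unfold axN
  split_ifs
  · exact le_rfl
  · exact Nat.pow_le_pow_right (by norm_num) (by omega)

lemma axQ_pos (m j : ℕ) : 0 < axQ m j := by unfold axQ; split_ifs <;> norm_num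

instance axFin (m : ℕ) : Finite (AxV m) := by
  have : Set.Finite {a : ℕ × (Fin m → Bool) × ℕ | a.1 ≤ 9 * m + 1 ∧ a.2.2 < axN m a.1} := by
    refine Set.Finite.subset ((Set.finite_Iic (9 * m + 1)).prod
      ((Set.finite_univ (α := Fin m → Bool)).prod (Set.finite_Iio (2 ^ (9 * m + 1))))) ?_
    rintro ⟨j, x, y⟩ ⟨h1, h2⟩
    simp only [Set.mem_prod, Set.mem_Iic, Set.mem_univ, Set.mem_Iio, true_and]
    refine ⟨h1, h2.trans_le ((axN_le m j).trans ?_)⟩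
    exact Nat.pow_le_pow_right (by norm_num) h1
  exact this

noncomputable instance axFintype (m : ℕ) : Fintype (AxV m) := Fintype.ofFinite _

def axH (m : ℕ) : SimpleGraph (AxV m) where
  Adj a b := axUp a.1 b.1 ∨ axUp b.1 a.1
  symm := ⟨fun a b h => h.symm⟩
  loopless := ⟨fun a h => by rcases h with h | h <;> · have := h.1; omega⟩

def axLv {m : ℕ} (v : AxV m) : ℕ := v.1.1

def axRoot {m : ℕ} (v : AxV m) : Fin m → Bool := v.1.2.1

/-- number of allowed root words -/
def axr (m j : ℕ) : ℕ := if j < 4 * m then 1 else 2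

lemma axR_symm {m j : ℕ} {x x' : Fin m → Bool} : axR m j x x' ↔ axR m j x' x := by
  unfold axR
  refine forall_congr' fun i => ?_
  rw [eq_comm (a := x i)]

lemma axR_card {m : ℕ} (hm : 1 ≤ m) (j : ℕ) (x : Fin m → Bool) :
    #{x' | axR m j x x'} = axr m j := by
  unfold axr
  split_ifs with h
  · rw [Finset.card_eq_one]
    refine ⟨x, ?_⟩
    ext x'
    simp only [Finset.mem_filter, Finset.mem_univ, true_and, Finset.mem_singleton]
    unfold axR
    constructor
    · intro h'; funext i
      rcases h' i with h1 | h1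
      · omega
      · exact h1.symm
    · rintro rfl i; exact Or.inr rfl
  · set i0 : Fin m := ⟨(j - 4 * m) % m, Nat.mod_lt _ (by omega)⟩ with hi0
    rw [Finset.card_eq_two]
    refine ⟨x, Function.update x i0 (!x i0), ?_, ?_⟩
    · intro he
      have := congrFun he i0
      simp at this
    · ext x'
      simp only [Finset.mem_filter, Finset.mem_univ, true_and, Finset.mem_singleton,
        Finset.mem_insert]
      unfold axR
      constructor
      · intro h'
        have h2 : ∀ i, i ≠ i0 → x i = x' i := by
          intro i hi
          rcases h' i with h1 | h1
          · exact absurd (Fin.ext h1.2) hi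
          · exact h1
        by_cases hx : x' i0 = x i0
        · left; funext i
          by_cases hi : i = i0
          · rw [hi, hx]
          · exact (h2 i hi).symm
        · right; funext i
          by_cases hi : i = i0
          · rw [hi]; simp; cases h3 : x' i0 <;> cases h4 : x i0 <;> simp_all
          · rw [Function.update_of_ne hi]; exact (h2 i hi).symm
      · intro h' i
        by_cases hi : i = i0
        · left; exact ⟨by omega, by rw [hi]⟩
        · right
          rcases h' with rfl | rfl
          · rfl
          · rw [Function.update_of_ne hi]

lemma ax_card_sub {m : ℕ} (p : AxV m → Prop) [DecidablePred p] (S : Finset (ℕ × (Fin m → Bool) × ℕ))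
    (h1 : ∀ v, p v → v.1 ∈ S)
    (h2 : ∀ a ∈ S, ∃ h : a.1 ≤ 9 * m + 1 ∧ a.2.2 < axN m a.1, p ⟨a, h⟩) :
    #{v | p v} = #S := by
  refine Finset.card_bij (fun v _ => v.1) ?_ ?_ ?_
  · intro v hv; exact h1 v (Finset.mem_filter.1 hv).2
  · intro v _ w _ h; exact Subtype.ext h
  · intro a ha
    obtain ⟨h, hp⟩ := h2 a ha
    exact ⟨⟨a, h⟩, by simpa using hp, rfl⟩

lemma ax_upcard {m : ℕ} (hm : 1 ≤ m) (v : AxV m) (hv : axLv v < 9 * m + 1) :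
    #{w | (axH m).Adj v w ∧ axLv w = axLv v + 1} = axr m (axLv v) * axQ m (axLv v) := by
  obtain ⟨⟨j, x, y⟩, hj, hy⟩ := v
  have hv' : j < 9 * m + 1 := hv
  refine (ax_card_sub _ ({j+1} ×ˢ ((Finset.univ.filter fun x' => axR m j x x') ×ˢ
    Finset.Ico (y * axQ m j) (y * axQ m j + axQ m j))) ?_ ?_).trans ?_
  rotate_left 2
  · simp [axR_card hm, axLv]
  · rintro ⟨⟨j', x', y'⟩, hj', hy'⟩ ⟨h | h, h2⟩
    · obtain ⟨h3, h4, h5⟩ := h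
      simp only [axLv] at h3 h4 h5 h2
      simp only [Finset.mem_product, Finset.mem_singleton, Finset.mem_filter, Finset.mem_univ,
        true_and, Finset.mem_Ico]
      have := Nat.div_add_mod y' (axQ m j)
      have h6 := Nat.mod_lt y' (axQ_pos m j)
      refine ⟨h3, h4, ?_, ?_⟩
      · rw [h5, mul_comm]; omega
      · rw [h5, mul_comm]; omega
    · have h3 := h.1; simp only [axLv] at h3 h2; omega
  · rintro ⟨j', x', y'⟩ h
    simp only [Finset.mem_product, Finset.mem_singleton, Finset.mem_filter, Finset.mem_univ,
      true_and, Finset.mem_Ico] at h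
    obtain ⟨rfl, hR, h1, h2⟩ := h
    have hdiv : y = y' / axQ m j := by
      symm
      rw [Nat.div_eq_iff (axQ_pos m j)]
      have := axQ_pos m j
      constructor <;> omega
    refine ⟨⟨by simp only; omega, ?_⟩, Or.inl ⟨rfl, hR, hdiv⟩, rfl⟩
    simp only
    rw [axN_succ, ← Nat.div_lt_iff_lt_mul (axQ_pos m j), ← hdiv]
    exact hy

lemma ax_downcard {m : ℕ} (hm : 1 ≤ m) (v : AxV m) (j : ℕ) (hv : axLv v = j + 1) :
    #{w | (axH m).Adj v w ∧ axLv v = axLv w + 1} = axr m j := by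
  obtain ⟨⟨j1, x, y⟩, hj, hy⟩ := v
  have hv' : j1 = j + 1 := hv
  subst hv'
  refine (ax_card_sub _ ({j} ×ˢ ((Finset.univ.filter fun x' => axR m j x x') ×ˢ
    {y / axQ m j})) ?_ ?_).trans ?_
  rotate_left 2
  · simp [axR_card hm]
  · rintro ⟨⟨j', x', y'⟩, hj', hy'⟩ ⟨h | h, h2⟩
    · have h3 := h.1; simp only [axLv] at h3 h2; omega
    · obtain ⟨h3, h4, h5⟩ := h
      simp only [axLv] at h3 h4 h5 h2
      obtain rfl : j = j' := by omega
      simp only [Finset.mem_product, Finset.mem_singleton, Finset.mem_filter, Finset.mem_univ,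
        true_and]
      exact ⟨axR_symm.1 h4, h5⟩
  · rintro ⟨j', x', y'⟩ h
    simp only [Finset.mem_product, Finset.mem_singleton, Finset.mem_filter, Finset.mem_univ,
      true_and] at h
    obtain ⟨rfl, hR, h1⟩ := h
    refine ⟨⟨by simp only; omega, ?_⟩, Or.inr ⟨rfl, axR_symm.1 hR, h1⟩, rfl⟩
    simp only
    rw [h1, Nat.div_lt_iff_lt_mul (axQ_pos m j'), ← axN_succ]
    exact hy

lemma ax_lvcard {m : ℕ} (j : ℕ) (hj : j ≤ 9 * m + 1) :
    #{v : AxV m | axLv v = j} = 2 ^ m * axN m j := by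
  refine (ax_card_sub _ ({j} ×ˢ ((Finset.univ : Finset (Fin m → Bool)) ×ˢ
    Finset.range (axN m j))) ?_ ?_).trans ?_
  rotate_left 2
  · simp
  · rintro ⟨⟨j', x', y'⟩, hj', hy'⟩ h
    simp only [axLv] at h hy'
    subst h
    simpa using hy'
  · rintro ⟨j', x', y'⟩ h
    simp only [Finset.mem_product, Finset.mem_singleton, Finset.mem_univ,
      true_and, Finset.mem_range] at h
    obtain ⟨rfl, h⟩ := h
    exact ⟨⟨hj, h⟩, rfl⟩

lemma ax_vcard {m : ℕ} : Fintype.card (AxV m) ≤ 4 * 2 ^ (10 * m) := by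
  have h1 : Fintype.card (AxV m) = ∑ j ∈ Finset.range (9 * m + 2), #{v : AxV m | axLv v = j} := by
    rw [← Finset.card_univ]
    refine Finset.card_eq_sum_card_fiberwise (f := axLv) ?_
    intro v _
    have := v.2.1
    simp only [Finset.coe_range, Set.mem_Iio, axLv]; omega
  rw [h1]
  calc ∑ j ∈ Finset.range (9 * m + 2), #{v : AxV m | axLv v = j}
      ≤ ∑ j ∈ Finset.range (9 * m + 2), 2 ^ m * 2 ^ j := by
        refine Finset.sum_le_sum fun j hj => ?_
        rw [ax_lvcard j (by have := Finset.mem_range.1 hj; omega)]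
        exact Nat.mul_le_mul_left _ (axN_le m j)
    _ = 2 ^ m * ∑ j ∈ Finset.range (9 * m + 2), 2 ^ j := by rw [Finset.mul_sum]
    _ ≤ 2 ^ m * 2 ^ (9 * m + 2) := by
        refine Nat.mul_le_mul_left _ ?_
        exact (Nat.geomSum_lt (le_refl 2) (by intro k hk; exact Finset.mem_range.1 hk)).le
    _ = _ := by rw [← pow_add, show m + (9 * m + 2) = 10 * m + 2 by ring, pow_add]; ring

/-- flips the root coordinates in the mask `z` below the level where they get mixed -/
def axFlip {m : ℕ} (z : Fin m → Bool) (j : ℕ) (x : Fin m → Bool) : Fin m → Bool :=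
  fun i => if j ≤ 4 * m + i then xor (x i) (z i) else x i

lemma axFlip_flip {m : ℕ} (z : Fin m → Bool) (j : ℕ) (x : Fin m → Bool) :
    axFlip z j (axFlip z j x) = x := by
  funext i; unfold axFlip; split_ifs <;> simp

lemma axFlip_R {m : ℕ} (z : Fin m → Bool) (j : ℕ) (x x' : Fin m → Bool) :
    axR m j (axFlip z j x) (axFlip z (j+1) x') ↔ axR m j x x' := by
  unfold axR
  refine forall_congr' fun i => ?_
  by_cases h : 4 * m ≤ j ∧ (i : ℕ) = (j - 4 * m) % m
  · simp [h]
  · simp only [h, false_or]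
    have hne : j ≠ 4 * m + i := by
      rintro rfl
      apply h
      refine ⟨by omega, ?_⟩
      rw [Nat.add_sub_cancel_left, Nat.mod_eq_of_lt i.2]
    unfold axFlip
    by_cases h1 : j ≤ 4 * m + i
    · rw [if_pos h1, if_pos (by omega)]; simp
    · rw [if_neg h1, if_neg (by omega)]

def axSigma {m : ℕ} (z : Fin m → Bool) : AxV m ≃ AxV m where
  toFun v := ⟨(v.1.1, axFlip z v.1.1 v.1.2.1, v.1.2.2), v.2⟩
  invFun v := ⟨(v.1.1, axFlip z v.1.1 v.1.2.1, v.1.2.2), v.2⟩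
  left_inv v := Subtype.ext (by simp [axFlip_flip])
  right_inv v := Subtype.ext (by simp [axFlip_flip])

lemma axSigma_val {m : ℕ} (z : Fin m → Bool) (v : AxV m) :
    (axSigma z v).1 = (v.1.1, axFlip z v.1.1 v.1.2.1, v.1.2.2) := rfl

lemma axSigma_up {m : ℕ} (z : Fin m → Bool) (v w : AxV m) :
    axUp (axSigma z v).1 (axSigma z w).1 ↔ axUp v.1 w.1 := by
  obtain ⟨⟨j, x, y⟩, hv⟩ := v
  obtain ⟨⟨j', x', y'⟩, hw⟩ := w
  simp only [axUp, axSigma_val]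
  refine and_congr_right ?_
  rintro rfl
  rw [axFlip_R]

lemma ax_good (m : ℕ) (hm : 1 ≤ m) : AxGood m (axH m) axLv axRoot where
  le v := v.2.1
  adj v w h := by
    rcases h with h | h
    · exact Or.inl h.1
    · exact Or.inr h.1
  down_pos v hv := by
    rw [ax_downcard hm v (axLv v - 1) (by omega)]
    unfold axr; split_ifs <;> norm_num
  up v hv hv2 := by
    rw [ax_downcard hm v (axLv v - 1) (by omega), ax_upcard hm v hv2]
    unfold axr axQ
    split_ifs <;> omega
  up0 v hv := by
    rw [ax_upcard hm v (by omega)]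
    unfold axr axQ
    split_ifs <;> omega
  deg v := by
    have h1 : graphDeg (axH m) v ≤ #{w | (axH m).Adj v w ∧ axLv w = axLv v + 1}
        + #{w | (axH m).Adj v w ∧ axLv v = axLv w + 1} := by
      refine le_trans (Finset.card_le_card ?_) (Finset.card_union_le _ _)
      intro w hw
      simp only [Finset.mem_filter, Finset.mem_univ, true_and, Finset.mem_union] at hw ⊢
      rcases hw with h | h
      · exact Or.inl ⟨Or.inl h, h.1⟩
      · exact Or.inr ⟨Or.inr h, h.1⟩
    have h2 : #{w | (axH m).Adj v w ∧ axLv w = axLv v + 1} ≤ 4 := by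
      by_cases h : axLv v < 9 * m + 1
      · rw [ax_upcard hm v h]; unfold axr axQ; split_ifs <;> norm_num
      · rw [Finset.card_eq_zero.2]
        · norm_num
        · rw [Finset.filter_eq_empty_iff]
          rintro w _ ⟨_, h3⟩
          have : axLv w ≤ 9 * m + 1 := w.2.1
          omega
    have h3 : #{w | (axH m).Adj v w ∧ axLv v = axLv w + 1} ≤ 2 := by
      by_cases h : axLv v = 0
      · rw [Finset.card_eq_zero.2]
        · norm_num
        · rw [Finset.filter_eq_empty_iff]
          rintro w _ ⟨_, h3⟩
          omega
      · rw [ax_downcard hm v (axLv v - 1) (by omega)]; unfold axr; split_ifs <;> norm_num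
    omega
  cardB := by rw [ax_lvcard 0 (by omega)]; simp [axN]
  cardW := by
    rw [ax_lvcard _ le_rfl]
    unfold axN
    rw [if_neg (by omega), Nat.add_sub_cancel, ← pow_add]
    congr 1; ring
  card := ax_vcard
  root_adj v w h hv hw := by
    have key : ∀ v w : AxV m, axUp v.1 w.1 → axLv v ≤ 4 * m → axLv w ≤ 4 * m →
        axRoot v = axRoot w := by
      intro v w h hv hw
      funext i
      rcases h.2.1 i with h1 | h1
      · have := h.1; unfold axLv at hv hw; omega
      · exact h1
    rcases h with h | h
    · exact key v w h hv hw
    · exact (key w v h hw hv).symm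
  root_inj v w hv hw h := by
    obtain ⟨⟨j, x, y⟩, hj, hy⟩ := v
    obtain ⟨⟨j', x', y'⟩, hj', hy'⟩ := w
    simp only [axLv, axRoot] at *
    subst hv hw h
    simp [axN] at hy hy'
    subst hy hy'
    rfl
  aut b b' hb hb' := by
    refine ⟨axSigma (fun i => xor (axRoot b i) (axRoot b' i)), ?_, fun v => rfl, ?_, ?_⟩
    · intro v w
      exact or_congr (axSigma_up _ v w) (axSigma_up _ w v)
    · intro v hv
      apply Subtype.ext
      obtain ⟨⟨j, x, y⟩, hv'⟩ := v
      simp only [axLv] at hv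
      subst hv
      simp only [axSigma_val, Prod.mk.injEq, true_and, and_true]
      funext i
      unfold axFlip
      rw [if_neg]
      have := i.2
      omega
    · obtain ⟨⟨j, x, y⟩, hj, hy⟩ := b
      obtain ⟨⟨j', x', y'⟩, hj', hy'⟩ := b'
      simp only [axLv, axRoot] at *
      subst hb hb'
      simp [axN] at hy hy'
      subst hy hy'
      apply Subtype.ext
      simp only [axSigma_val, Prod.mk.injEq, true_and, and_true]
      funext i
      simp [axFlip]

lemma ax_card_comp {V : Type*} [Fintype V] {k : ℕ} (e : Fin k ≃ V) (p : V → Prop)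
    [DecidablePred p] [DecidablePred fun i => p (e i)] :
    #{i | p (e i)} = #{v | p v} :=
  Finset.card_equiv e (by intro i; simp)

lemma ax_good_fin (m : ℕ) (hm : 1 ≤ m) : ∃ k : ℕ, ∃ H : SimpleGraph (Fin k),
    ∃ lv : Fin k → ℕ, ∃ root : Fin k → (Fin m → Bool), AxGood m H lv root := by
  have G := ax_good m hm
  let e := (Fintype.equivFin (AxV m)).symm
  refine ⟨Fintype.card (AxV m), (axH m).comap e, fun i => axLv (e i), fun i => axRoot (e i), ?_⟩
  have hadj : ∀ v w, ((axH m).comap e).Adj v w ↔ (axH m).Adj (e v) (e w) := fun v w => Iff.rfl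
  refine ⟨fun v => G.le _, fun v w h => G.adj _ _ h, ?_, ?_, ?_, ?_, ?_, ?_, ?_,
    fun v w h => G.root_adj _ _ h, ?_, ?_⟩
  · intro v hv
    simp only [hadj]
    rw [ax_card_comp e (fun w => (axH m).Adj (e v) w ∧ axLv (e v) = axLv w + 1)]
    exact G.down_pos _ hv
  · intro v hv hv2
    simp only [hadj]
    rw [ax_card_comp e (fun w => (axH m).Adj (e v) w ∧ axLv (e v) = axLv w + 1),
      ax_card_comp e (fun w => (axH m).Adj (e v) w ∧ axLv w = axLv (e v) + 1)]
    exact G.up _ hv hv2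
  · intro v hv
    simp only [hadj]
    rw [ax_card_comp e (fun w => (axH m).Adj (e v) w ∧ axLv w = axLv (e v) + 1)]
    exact G.up0 _ hv
  · intro v
    unfold graphDeg
    simp only [hadj]
    rw [ax_card_comp e (fun w => (axH m).Adj (e v) w)]
    exact G.deg _
  · rw [ax_card_comp e (fun w => axLv w = 0)]; exact G.cardB
  · rw [ax_card_comp e (fun w => axLv w = 9 * m + 1)]; exact G.cardW
  · rw [Fintype.card_fin]; exact G.card
  · intro v w hv hw h
    exact e.injective (G.root_inj _ _ hv hw h)
  · intro b b' hb hb'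
    obtain ⟨σ, h1, h2, h3, h4⟩ := G.aut _ _ hb hb'
    refine ⟨(e.trans σ).trans e.symm, ?_, ?_, ?_, ?_⟩
    · intro v w; simp [h1]
    · intro v; simp [h2]
    · intro v hv; simp [h3 _ hv]
    · simp [h4]

end concrete

/-- Lemma 4.1: the auxiliary graph with a small set `B`, a large set `W`, uniform harmonic
measure on `B` from `W`, and the stated quantitative hitting estimates. -/
theorem aux_expander_graph :
    ∃ μ > (0 : ℝ), ∃ c > (0 : ℝ), ∃ C > (0 : ℝ), ∀ m : ℕ, 1 ≤ m →
      ∃ k : ℕ, ∃ H : SimpleGraph (Fin k), ∃ B W : Finset (Fin k),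
        H.Connected ∧
        (∀ v, graphDeg H v ≤ 6) ∧
        c * 2 ^ (10 * m) ≤ (k : ℝ) ∧ (k : ℝ) ≤ C * 2 ^ (10 * m) ∧
        Disjoint B W ∧ B.card = 2 ^ m ∧ W.card = 2 ^ (10 * m) ∧
        (∀ b ∈ B, prHitBefore (srwP H) (B.erase b) W b ≤ C / 2 ^ (4 * m)) ∧
        (∀ h : Fin k,
          c * (k : ℝ) / 2 ^ m ≤ expHit (srwP H) (B.erase h) h ∧
          expHit (srwP H) (B.erase h) h ≤ C * (k : ℝ) / 2 ^ m) ∧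
        (∀ h : Fin k, c ≤ survSeq (srwP H) (B.erase h) (k / 2 ^ m) h) ∧
        (∀ b ∈ B, μ ≤ condEscapeProb (srwP H) B W b) ∧
        (∀ b ∈ B, ∀ b' ∈ B, condEscapeProb (srwP H) B W b = condEscapeProb (srwP H) B W b') ∧
        (∀ v ∈ W, ∀ b ∈ B, prHitAt (srwP H) B b v = 1 / 2 ^ m) := by
  refine ⟨1/2, by norm_num, 1/512, by norm_num, 32, by norm_num, fun m hm => ?_⟩
  obtain ⟨k, H, lv, root, G⟩ := ax_good_fin m hm
  have hk1 : 2 ^ (10 * m) ≤ k := by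
    have := Finset.card_le_univ (Finset.univ.filter fun v => lv v = 9 * m + 1)
    rw [G.cardW, Fintype.card_fin] at this
    exact this
  have hk2 : k ≤ 4 * 2 ^ (10 * m) := by have := G.card; rwa [Fintype.card_fin] at this
  have hk1' : (2:ℝ) ^ (10 * m) ≤ k := by exact_mod_cast hk1
  have hk2' : (k:ℝ) ≤ 4 * 2 ^ (10 * m) := by exact_mod_cast hk2
  have hp : (0:ℝ) < 2 ^ (10 * m) := by positivity
  have hpm : (0:ℝ) < 2 ^ m := by positivity
  have hN : k / 2 ^ m ≤ 2 * 2 ^ (9 * m + 1) := by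
    apply Nat.div_le_of_le_mul
    refine hk2.trans (le_of_eq ?_)
    rw [show 10 * m = m + 9 * m by ring, pow_add, pow_succ]; ring
  refine ⟨k, H, Finset.univ.filter fun v => lv v = 0,
    Finset.univ.filter fun v => lv v = 9 * m + 1, G.conn hm, G.deg, by linarith, by linarith,
    AxGood.disj lv, G.cardB, G.cardW, ?_, ?_, ?_, ?_, ?_, ?_⟩
  · intro b hb
    refine (G.part1 b (by simpa using hb)).trans ?_
    gcongr; norm_num
  · intro h
    constructor
    · refine le_trans ?_ (G.part2l hm h _ hN)
      have h1 : (k:ℝ) ≤ 2 ^ m * ((k / 2 ^ m : ℕ) + 1) := by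
        exact_mod_cast (Nat.lt_mul_div_succ k (show 0 < 2 ^ m by positivity)).le
      rw [div_le_iff₀ hpm]
      linarith
    · refine (G.part2u hm h).2.trans ?_
      rw [le_div_iff₀ hpm]
      have : (16:ℝ) * 2 ^ (9 * m + 1) * 2 ^ m = 32 * 2 ^ (10 * m) := by
        rw [show 10 * m = m + 9 * m by ring, pow_add, pow_succ]; ring
      rw [this]
      linarith
  · intro h
    exact G.part3 hm h _ hN
  · intro b hb
    exact G.part4 hm b (by simpa using hb)
  · intro b hb b' hb'
    exact G.part4' b b' (by simpa using hb) (by simpa using hb')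
  · intro v hv b hb
    rw [ax_prHitAt_eq]
    exact G.part5 hm v b (by simpa using hv) (by simpa using hb)
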